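/- Let ι_{a1}, ι_{a2}, ι_{b1}, ι_{b2}, ι_{e1}, ι_{e2} be nonempty finite types with ι_{a1} = ι_{b1} and ι_{a2} = ι_{b2}, and let ρ be a pure density matrix on the product type ι_{a1} × ι_{a2} × ι_{b1} × ι_{b2} × ι_{e1} × ι_{e2}. Assume: (i) ρ^{a1 a2 b2} = ρ^{a1 b2} ⊗ ρ^{a2} (after the obvious reindexing); (ii) ρ^{a1 a2 b1 b2} is symmetric under exchanging the pair (a1, a2) with the pair (b1, b2); (iii) S(ρ^{b1}) ≤ S(ρ^{e1}); (iv) S(ρ^{a1 b2}) ≥ S(ρ^{b1 e1}). Then the quantum mutual information between the parties is bounded by the local entropy of A: S(ρ^{a1 a2}) + S(ρ^{b1 b2}) − S(ρ^{a1 a2 b1 b2}) ≤ S(ρ^{a1 a2}). -/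

import Mathlib

open Matrix ComplexOrder

/-- Von Neumann entropy of a (Hermitian) matrix: `∑ i, negMulLog λᵢ` over its eigenvalues. -/
noncomputable def vnEntropy {ι : Type*} [Fintype ι] [DecidableEq ι] (M : Matrix ι ι ℂ) : ℝ :=
  if h : M.IsHermitian then ∑ i, Real.negMulLog (h.eigenvalues i) else 0

/-- A density matrix: positive semidefinite with unit trace. -/
def IsDensityMatrix {ι : Type*} [Fintype ι] (ρ : Matrix ι ι ℂ) : Prop :=
  ρ.PosSemidef ∧ ρ.trace = 1

/-- A pure density matrix: a density matrix of the form `|w⟩⟨w|` for a unit vector `w`. -/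
def IsPureDensityMatrix {ι : Type*} [Fintype ι] (ρ : Matrix ι ι ℂ) : Prop :=
  IsDensityMatrix ρ ∧ ∃ w : ι → ℂ, (∑ i, ‖w i‖ ^ 2 = 1) ∧ ρ = Matrix.vecMulVec w (star w)

section
/- Index types: positions are (a1, a2, b1, b2, e1, e2), with `ι_{a1} = ι_{b1} = ι1` and
`ι_{a2} = ι_{b2} = ι2`. -/
variable {ι1 ι2 ι5 ι6 : Type*} [Fintype ι1] [Fintype ι2] [Fintype ι5] [Fintype ι6]

/-- Reduced density matrix on (a1, a2, b1, b2). -/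
noncomputable def redA1A2B1B2
    (ρ : Matrix (ι1 × ι2 × ι1 × ι2 × ι5 × ι6) (ι1 × ι2 × ι1 × ι2 × ι5 × ι6) ℂ) :
    Matrix (ι1 × ι2 × ι1 × ι2) (ι1 × ι2 × ι1 × ι2) ℂ :=
  fun p q => ∑ x5 : ι5, ∑ x6 : ι6,
    ρ (p.1, p.2.1, p.2.2.1, p.2.2.2, x5, x6) (q.1, q.2.1, q.2.2.1, q.2.2.2, x5, x6)

/-- Reduced density matrix on (a1, a2, b2). -/
noncomputable def redA1A2B2
    (ρ : Matrix (ι1 × ι2 × ι1 × ι2 × ι5 × ι6) (ι1 × ι2 × ι1 × ι2 × ι5 × ι6) ℂ) :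
    Matrix (ι1 × ι2 × ι2) (ι1 × ι2 × ι2) ℂ :=
  fun p q => ∑ x3 : ι1, ∑ x5 : ι5, ∑ x6 : ι6,
    ρ (p.1, p.2.1, x3, p.2.2, x5, x6) (q.1, q.2.1, x3, q.2.2, x5, x6)

/-- Reduced density matrix on (a1, b2). -/
noncomputable def redA1B2
    (ρ : Matrix (ι1 × ι2 × ι1 × ι2 × ι5 × ι6) (ι1 × ι2 × ι1 × ι2 × ι5 × ι6) ℂ) :
    Matrix (ι1 × ι2) (ι1 × ι2) ℂ :=
  fun p q => ∑ x2 : ι2, ∑ x3 : ι1, ∑ x5 : ι5, ∑ x6 : ι6,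
    ρ (p.1, x2, x3, p.2, x5, x6) (q.1, x2, x3, q.2, x5, x6)

/-- Reduced density matrix on (a2). -/
noncomputable def redA2
    (ρ : Matrix (ι1 × ι2 × ι1 × ι2 × ι5 × ι6) (ι1 × ι2 × ι1 × ι2 × ι5 × ι6) ℂ) :
    Matrix ι2 ι2 ℂ :=
  fun p q => ∑ x1 : ι1, ∑ x3 : ι1, ∑ x4 : ι2, ∑ x5 : ι5, ∑ x6 : ι6,
    ρ (x1, p, x3, x4, x5, x6) (x1, q, x3, x4, x5, x6)

/-- Reduced density matrix on (b1). -/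
noncomputable def redB1
    (ρ : Matrix (ι1 × ι2 × ι1 × ι2 × ι5 × ι6) (ι1 × ι2 × ι1 × ι2 × ι5 × ι6) ℂ) :
    Matrix ι1 ι1 ℂ :=
  fun p q => ∑ x1 : ι1, ∑ x2 : ι2, ∑ x4 : ι2, ∑ x5 : ι5, ∑ x6 : ι6,
    ρ (x1, x2, p, x4, x5, x6) (x1, x2, q, x4, x5, x6)

/-- Reduced density matrix on (e1). -/
noncomputable def redE1
    (ρ : Matrix (ι1 × ι2 × ι1 × ι2 × ι5 × ι6) (ι1 × ι2 × ι1 × ι2 × ι5 × ι6) ℂ) :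
    Matrix ι5 ι5 ℂ :=
  fun p q => ∑ x1 : ι1, ∑ x2 : ι2, ∑ x3 : ι1, ∑ x4 : ι2, ∑ x6 : ι6,
    ρ (x1, x2, x3, x4, p, x6) (x1, x2, x3, x4, q, x6)

/-- Reduced density matrix on (b1, e1). -/
noncomputable def redB1E1
    (ρ : Matrix (ι1 × ι2 × ι1 × ι2 × ι5 × ι6) (ι1 × ι2 × ι1 × ι2 × ι5 × ι6) ℂ) :
    Matrix (ι1 × ι5) (ι1 × ι5) ℂ :=
  fun p q => ∑ x1 : ι1, ∑ x2 : ι2, ∑ x4 : ι2, ∑ x6 : ι6,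
    ρ (x1, x2, p.1, x4, p.2, x6) (x1, x2, q.1, x4, q.2, x6)

/-- Reduced density matrix on (b1, b2). -/
noncomputable def redB1B2
    (ρ : Matrix (ι1 × ι2 × ι1 × ι2 × ι5 × ι6) (ι1 × ι2 × ι1 × ι2 × ι5 × ι6) ℂ) :
    Matrix (ι1 × ι2) (ι1 × ι2) ℂ :=
  fun p q => ∑ x1 : ι1, ∑ x2 : ι2, ∑ x5 : ι5, ∑ x6 : ι6,
    ρ (x1, x2, p.1, p.2, x5, x6) (x1, x2, q.1, q.2, x5, x6)

end

/-- Reduced density matrix on (a1, a2). -/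
noncomputable def redA1A2 {ι1 ι2 ι5 ι6 : Type*}
    [Fintype ι1] [Fintype ι2] [Fintype ι5] [Fintype ι6]
    (ρ : Matrix (ι1 × ι2 × ι1 × ι2 × ι5 × ι6) (ι1 × ι2 × ι1 × ι2 × ι5 × ι6) ℂ) :
    Matrix (ι1 × ι2) (ι1 × ι2) ℂ :=
  fun p q => ∑ x3 : ι1, ∑ x4 : ι2, ∑ x5 : ι5, ∑ x6 : ι6,
    ρ (p.1, p.2, x3, x4, x5, x6) (q.1, q.2, x3, x4, x5, x6)


/-- Spectral decomposition data of a Hermitian matrix. -/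
structure SpecDec {ι : Type*} [Fintype ι] [DecidableEq ι] (M U : Matrix ι ι ℂ) (p : ι → ℝ) :
    Prop where
  unit' : Uᴴ * U = 1
  unit : U * Uᴴ = 1
  eq : M = U * diagonal (fun i => (p i : ℂ)) * Uᴴ

theorem SpecDec.isHermitian {ι : Type*} [Fintype ι] [DecidableEq ι] {M U : Matrix ι ι ℂ}
    {p : ι → ℝ} (h : SpecDec M U p) : M.IsHermitian := by
  have : (diagonal (fun i => (p i : ℂ)))ᴴ = diagonal (fun i => (p i : ℂ)) := by
    rw [diagonal_conjTranspose]; congr 1; ext i; simp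
  unfold Matrix.IsHermitian
  rw [h.eq]
  simp [Matrix.conjTranspose_mul, this, Matrix.mul_assoc]

theorem SpecDec.charpoly {ι : Type*} [Fintype ι] [DecidableEq ι] {M U : Matrix ι ι ℂ}
    {p : ι → ℝ} (h : SpecDec M U p) :
    M.charpoly = ∏ i, (Polynomial.X - Polynomial.C (p i : ℂ)) := by
  rw [h.eq, Matrix.charpoly_mul_comm, ← Matrix.mul_assoc, h.unit', Matrix.one_mul,
    charpoly_diagonal]

theorem vnEntropy_eq_roots {ι : Type*} [Fintype ι] [DecidableEq ι] {M : Matrix ι ι ℂ}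
    (h : M.IsHermitian) :
    vnEntropy M = (M.charpoly.roots.map (fun z : ℂ => Real.negMulLog z.re)).sum := by
  rw [vnEntropy, dif_pos h, h.roots_charpoly_eq_eigenvalues, Multiset.map_map]
  simp [Function.comp_def]

theorem SpecDec.entropy {ι : Type*} [Fintype ι] [DecidableEq ι] {M U : Matrix ι ι ℂ}
    {p : ι → ℝ} (h : SpecDec M U p) : vnEntropy M = ∑ i, Real.negMulLog (p i) := by
  rw [vnEntropy_eq_roots h.isHermitian, h.charpoly, Polynomial.roots_prod]
  · simp
  · simp [Finset.prod_ne_zero_iff, Polynomial.X_sub_C_ne_zero]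

theorem exists_specDec {ι : Type*} [Fintype ι] [DecidableEq ι] {M : Matrix ι ι ℂ}
    (h : M.PosSemidef) : ∃ U p, SpecDec M U p ∧ ∀ i, 0 ≤ p i := by
  refine ⟨h.1.eigenvectorUnitary, h.1.eigenvalues, ⟨?_, ?_, ?_⟩, h.eigenvalues_nonneg⟩
  · exact Unitary.coe_star_mul_self _
  · exact Unitary.coe_mul_star_self _
  · exact h.1.spectral_theorem

theorem vnEntropy_submatrix {ι κ : Type*} [Fintype ι] [DecidableEq ι] [Fintype κ] [DecidableEq κ]
    (e : κ ≃ ι) {M : Matrix ι ι ℂ} (h : M.IsHermitian) :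
    vnEntropy (M.submatrix e e) = vnEntropy M := by
  rw [vnEntropy_eq_roots h, vnEntropy_eq_roots (h.submatrix e)]
  have := Matrix.charpoly_reindex e.symm M
  simp only [Matrix.reindex_apply, Equiv.symm_symm] at this
  rw [this]

theorem vnEntropy_pure {ι κ : Type*} [Fintype ι] [DecidableEq ι] [Fintype κ] [DecidableEq κ]
    (M : Matrix ι κ ℂ) : vnEntropy (M * Mᴴ) = vnEntropy (Mᵀ * Mᵀᴴ) := by
  rw [vnEntropy_eq_roots (Matrix.isHermitian_mul_conjTranspose_self M),
    vnEntropy_eq_roots (Matrix.isHermitian_mul_conjTranspose_self Mᵀ)]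
  have h2 : (Mᵀ * Mᵀᴴ) = (Mᴴ * M)ᵀ := by
    rw [Matrix.transpose_mul]; rfl
  rw [h2, Matrix.charpoly_transpose]
  have h := Matrix.charpoly_mul_comm' M Mᴴ
  have h' := congrArg (fun P : Polynomial ℂ =>
    (P.roots.map (fun z : ℂ => Real.negMulLog z.re)).sum) h
  rw [Polynomial.roots_mul (mul_ne_zero (by simp) (Matrix.charpoly_monic _).ne_zero),
    Polynomial.roots_mul (mul_ne_zero (by simp) (Matrix.charpoly_monic _).ne_zero)] at h'
  simpa [Multiset.map_nsmul, Multiset.sum_nsmul] using h'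

theorem SpecDec.kronecker {ι κ : Type*} [Fintype ι] [DecidableEq ι] [Fintype κ] [DecidableEq κ]
    {M U : Matrix ι ι ℂ} {p : ι → ℝ} {N V : Matrix κ κ ℂ} {q : κ → ℝ}
    (h : SpecDec M U p) (k : SpecDec N V q) :
    SpecDec (kroneckerMap (· * ·) M N) (kroneckerMap (· * ·) U V) (fun x => p x.1 * q x.2) := by
  refine ⟨?_, ?_, ?_⟩
  · rw [conjTranspose_kronecker, ← mul_kronecker_mul, h.unit', k.unit', one_kronecker_one]
  · rw [conjTranspose_kronecker, ← mul_kronecker_mul, h.unit, k.unit, one_kronecker_one]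
  · have : diagonal (fun x : ι × κ => ((p x.1 * q x.2 : ℝ) : ℂ)) =
        kroneckerMap (· * ·) (diagonal (fun i => (p i : ℂ))) (diagonal (fun i => (q i : ℂ))) := by
      rw [diagonal_kronecker_diagonal]; simp
    rw [this, conjTranspose_kronecker, ← mul_kronecker_mul, ← mul_kronecker_mul, ← h.eq, ← k.eq]

theorem SpecDec.trace {ι : Type*} [Fintype ι] [DecidableEq ι] {M U : Matrix ι ι ℂ}
    {p : ι → ℝ} (h : SpecDec M U p) : M.trace = ((∑ i, p i : ℝ) : ℂ) := by
  rw [h.eq, Matrix.trace_mul_comm, ← Matrix.mul_assoc, h.unit', Matrix.one_mul,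
    Matrix.trace_diagonal]
  push_cast; rfl

theorem vnEntropy_kronecker {ι κ : Type*} [Fintype ι] [DecidableEq ι] [Fintype κ] [DecidableEq κ]
    {M : Matrix ι ι ℂ} {N : Matrix κ κ ℂ} (hM : M.PosSemidef) (hN : N.PosSemidef)
    (tM : M.trace = 1) (tN : N.trace = 1) :
    vnEntropy (kroneckerMap (· * ·) M N) = vnEntropy M + vnEntropy N := by
  obtain ⟨U, p, h, -⟩ := exists_specDec hM
  obtain ⟨V, q, k, -⟩ := exists_specDec hN
  rw [(h.kronecker k).entropy, h.entropy, k.entropy, Fintype.sum_prod_type]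
  have h1 : ∑ i, p i = 1 := by have := h.trace; rw [tM] at this; exact_mod_cast this.symm
  have k1 : ∑ i, q i = 1 := by have := k.trace; rw [tN] at this; exact_mod_cast this.symm
  simp only [Real.negMulLog_mul, Finset.sum_add_distrib, ← Finset.mul_sum, ← Finset.sum_mul, h1, k1,
    one_mul]

/-- The variational functional for the resolvent of the relative modular operator. -/
noncomputable def qF {ι : Type*} [Fintype ι] (t : ℝ) (ρ σ Y : Matrix ι ι ℂ) : ℝ :=
  2 * (Y * ρ).trace.re - (Y * Yᴴ * σ).trace.re - t * (Yᴴ * Y * ρ).trace.re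

theorem qF_eq {ι : Type*} [Fintype ι] [DecidableEq ι] {ρ U σ V : Matrix ι ι ℂ} {p q : ι → ℝ}
    (h : SpecDec ρ U p) (k : SpecDec σ V q) (t : ℝ) (Y : Matrix ι ι ℂ) :
    qF t ρ σ Y = ∑ i, ∑ j, (2 * (p i * ((Vᴴ * Y * U) j i * (Uᴴ * V) i j).re)
      - (q j + t * p i) * Complex.normSq ((Vᴴ * Y * U) j i)) := by
  set Z := Vᴴ * Y * U with hZ
  have e1 : (Y * ρ).trace = (Z * diagonal (fun i => (p i : ℂ)) * (Uᴴ * V)).trace := by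
    rw [hZ, h.eq]
    have : Vᴴ * Y * U * diagonal (fun i => (p i : ℂ)) * (Uᴴ * V)
      = (Vᴴ * (Y * U * diagonal (fun i => (p i : ℂ)) * Uᴴ)) * V := by
      simp only [Matrix.mul_assoc]
    rw [this, Matrix.trace_mul_comm _ V, ← Matrix.mul_assoc V, k.unit, Matrix.one_mul]
    simp only [Matrix.mul_assoc]
  have e2 : (Y * Yᴴ * σ).trace = (Zᴴ * diagonal (fun i => (q i : ℂ)) * Z).trace := by
    rw [hZ, k.eq]
    have : (Vᴴ * Y * U)ᴴ * diagonal (fun i => (q i : ℂ)) * (Vᴴ * Y * U)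
      = Uᴴ * (Yᴴ * (V * diagonal (fun i => (q i : ℂ)) * Vᴴ) * Y) * U := by
      simp only [Matrix.conjTranspose_mul, Matrix.conjTranspose_conjTranspose, Matrix.mul_assoc]
    rw [this, Matrix.trace_mul_comm _ U, ← Matrix.mul_assoc U, h.unit, Matrix.one_mul,
      Matrix.trace_mul_comm (Yᴴ * _) Y]
    simp only [Matrix.mul_assoc]
  have e3 : (Yᴴ * Y * ρ).trace = (Z * diagonal (fun i => (p i : ℂ)) * Zᴴ).trace := by
    rw [hZ, h.eq]
    have : (Vᴴ * Y * U) * diagonal (fun i => (p i : ℂ)) * (Vᴴ * Y * U)ᴴ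
      = Vᴴ * (Y * (U * diagonal (fun i => (p i : ℂ)) * Uᴴ) * Yᴴ) * V := by
      simp only [Matrix.conjTranspose_mul, Matrix.conjTranspose_conjTranspose, Matrix.mul_assoc]
    rw [this, Matrix.trace_mul_comm _ V, ← Matrix.mul_assoc V, k.unit, Matrix.one_mul,
      Matrix.trace_mul_comm (Y * _) Yᴴ]
    simp only [Matrix.mul_assoc]
  have f1 : (Y * ρ).trace.re = ∑ i, ∑ j, p i * (Z j i * (Uᴴ * V) i j).re := by
    rw [e1, Matrix.trace, Complex.re_sum, Finset.sum_comm]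
    refine Finset.sum_congr rfl fun j _ => ?_
    rw [Matrix.diag_apply, Matrix.mul_apply, Complex.re_sum]
    refine Finset.sum_congr rfl fun i _ => ?_
    rw [Matrix.mul_diagonal, mul_right_comm, mul_comm, Complex.re_ofReal_mul]
  have f2 : (Y * Yᴴ * σ).trace.re = ∑ i, ∑ j, q j * Complex.normSq (Z j i) := by
    rw [e2, Matrix.trace, Complex.re_sum]
    refine Finset.sum_congr rfl fun i _ => ?_
    rw [Matrix.diag_apply, Matrix.mul_apply, Complex.re_sum]
    refine Finset.sum_congr rfl fun j _ => ?_
    rw [Matrix.mul_diagonal, mul_right_comm, mul_comm, Complex.re_ofReal_mul,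
      Matrix.conjTranspose_apply, Complex.star_def, ← Complex.normSq_eq_conj_mul_self,
      Complex.ofReal_re]
  have f3 : (Yᴴ * Y * ρ).trace.re = ∑ i, ∑ j, p i * Complex.normSq (Z j i) := by
    rw [e3, Matrix.trace, Complex.re_sum, Finset.sum_comm]
    refine Finset.sum_congr rfl fun j _ => ?_
    rw [Matrix.diag_apply, Matrix.mul_apply, Complex.re_sum]
    refine Finset.sum_congr rfl fun i _ => ?_
    rw [Matrix.mul_diagonal, mul_right_comm, mul_comm, Complex.re_ofReal_mul,
      Matrix.conjTranspose_apply, Complex.star_def, Complex.mul_conj,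
      Complex.ofReal_re]
  rw [qF, f1, f2, f3]
  simp only [Finset.mul_sum, ← Finset.sum_sub_distrib]
  refine Finset.sum_congr rfl fun i _ => Finset.sum_congr rfl fun j _ => ?_
  ring

/-- The supremum of `qF`. -/
noncomputable def qS {ι : Type*} [Fintype ι] (W : ι → ι → ℝ) (p q : ι → ℝ) (t : ℝ) : ℝ :=
  ∑ i, ∑ j, W i j * (p i ^ 2 / (q j + t * p i))

theorem qF_le {ι : Type*} [Fintype ι] [DecidableEq ι] {ρ U σ V : Matrix ι ι ℂ} {p q : ι → ℝ}
    (h : SpecDec ρ U p) (k : SpecDec σ V q) (hp : ∀ i, 0 ≤ p i) (hq : ∀ j, 0 < q j)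
    {t : ℝ} (ht : 0 ≤ t) (Y : Matrix ι ι ℂ) :
    qF t ρ σ Y ≤ qS (fun i j => Complex.normSq ((Uᴴ * V) i j)) p q t := by
  rw [qF_eq h k, qS]
  refine Finset.sum_le_sum fun i _ => Finset.sum_le_sum fun j _ => ?_
  have hd : 0 < q j + t * p i := add_pos_of_pos_of_nonneg (hq j) (mul_nonneg ht (hp i))
  generalize (Vᴴ * Y * U) j i = z
  generalize (Uᴴ * V) i j = c
  generalize q j + t * p i = d at *
  generalize p i = x
  rw [← mul_div_assoc, le_div_iff₀ hd]
  simp only [Complex.normSq_apply, Complex.mul_re]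
  nlinarith [sq_nonneg (d * z.re - x * c.re), sq_nonneg (d * z.im + x * c.im)]

theorem qF_attained {ι : Type*} [Fintype ι] [DecidableEq ι] {ρ U σ V : Matrix ι ι ℂ} {p q : ι → ℝ}
    (h : SpecDec ρ U p) (k : SpecDec σ V q) (hp : ∀ i, 0 ≤ p i) (hq : ∀ j, 0 < q j)
    {t : ℝ} (ht : 0 ≤ t) : ∃ Y : Matrix ι ι ℂ,
    qF t ρ σ Y = qS (fun i j => Complex.normSq ((Uᴴ * V) i j)) p q t := by
  let Z : Matrix ι ι ℂ := fun j i => ((p i / (q j + t * p i) : ℝ) : ℂ) * star ((Uᴴ * V) i j)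
  refine ⟨V * Z * Uᴴ, ?_⟩
  have hZ : Vᴴ * (V * Z * Uᴴ) * U = Z := by
    have : Vᴴ * (V * Z * Uᴴ) * U = (Vᴴ * V) * Z * (Uᴴ * U) := by simp only [Matrix.mul_assoc]
    rw [this, h.unit', k.unit', Matrix.one_mul, Matrix.mul_one]
  rw [qF_eq h k, qS, hZ]
  refine Finset.sum_congr rfl fun i _ => Finset.sum_congr rfl fun j _ => ?_
  have hd : 0 < q j + t * p i := add_pos_of_pos_of_nonneg (hq j) (mul_nonneg ht (hp i))
  simp only [Z]
  generalize (Uᴴ * V) i j = c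
  generalize q j + t * p i = d at *
  generalize p i = x
  rw [mul_assoc, Complex.re_ofReal_mul, Complex.star_def, ← Complex.normSq_eq_conj_mul_self,
    Complex.normSq_mul, Complex.normSq_conj, Complex.normSq_ofReal, Complex.ofReal_re]
  field_simp
  ring

/-- Partial trace over the second factor. -/
noncomputable def ptr {α γ : Type*} [Fintype γ] (M : Matrix (α × γ) (α × γ) ℂ) : Matrix α α ℂ :=
  fun a b => ∑ c, M (a, c) (b, c)

theorem trace_kron_mul {α γ : Type*} [Fintype α] [Fintype γ] [DecidableEq α] [DecidableEq γ]
    (Y : Matrix α α ℂ) (M : Matrix (α × γ) (α × γ) ℂ) :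
    (kroneckerMap (· * ·) Y (1 : Matrix γ γ ℂ) * M).trace = (Y * ptr M).trace := by
  simp only [Matrix.trace, Matrix.diag_apply, Matrix.mul_apply, Fintype.sum_prod_type, ptr,
    kroneckerMap_apply, Matrix.one_apply, mul_ite, mul_one, mul_zero, ite_mul, zero_mul,
    Finset.sum_ite_eq, Finset.mem_univ, if_true, Finset.mul_sum]
  refine Finset.sum_congr rfl fun i _ => ?_
  rw [Finset.sum_comm]

theorem qF_kron {α γ : Type*} [Fintype α] [Fintype γ] [DecidableEq α] [DecidableEq γ]
    (Y : Matrix α α ℂ) (ρ σ : Matrix (α × γ) (α × γ) ℂ) (t : ℝ) :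
    qF t ρ σ (kroneckerMap (· * ·) Y (1 : Matrix γ γ ℂ)) = qF t (ptr ρ) (ptr σ) Y := by
  simp only [qF, conjTranspose_kronecker, ← mul_kronecker_mul, Matrix.conjTranspose_one,
    Matrix.one_mul, trace_kron_mul]

theorem qS_mono {α γ : Type*} [Fintype α] [Fintype γ] [DecidableEq α] [DecidableEq γ]
    {ρ σ U V : Matrix (α × γ) (α × γ) ℂ} {p q : α × γ → ℝ}
    {U' V' : Matrix α α ℂ} {p' q' : α → ℝ}
    (h : SpecDec ρ U p) (k : SpecDec σ V q) (hp : ∀ i, 0 ≤ p i) (hq : ∀ j, 0 < q j)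
    (h' : SpecDec (ptr ρ) U' p') (k' : SpecDec (ptr σ) V' q')
    (hp' : ∀ i, 0 ≤ p' i) (hq' : ∀ j, 0 < q' j) {t : ℝ} (ht : 0 ≤ t) :
    qS (fun i j => Complex.normSq ((U'ᴴ * V') i j)) p' q' t ≤
    qS (fun i j => Complex.normSq ((Uᴴ * V) i j)) p q t := by
  obtain ⟨Y, hY⟩ := qF_attained h' k' hp' hq' ht
  rw [← hY, ← qF_kron]
  exact qF_le h k hp hq ht _

/-- The integral of `qS` from `0` to `T`. -/
noncomputable def qL {ι : Type*} [Fintype ι] (W : ι → ι → ℝ) (p q : ι → ℝ) (t : ℝ) : ℝ :=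
  ∑ i, ∑ j, W i j * (p i * (Real.log (q j + t * p i) - Real.log (q j)))

/-- Relative entropy in spectral form. -/
noncomputable def qD {ι : Type*} [Fintype ι] (W : ι → ι → ℝ) (p q : ι → ℝ) : ℝ :=
  ∑ i, ∑ j, W i j * (p i * (Real.log (p i) - Real.log (q j)))

theorem qL_hasDerivAt {ι : Type*} [Fintype ι] (W : ι → ι → ℝ) (p q : ι → ℝ)
    (hp : ∀ i, 0 ≤ p i) (hq : ∀ j, 0 < q j) {t : ℝ} (ht : 0 ≤ t) :
    HasDerivAt (qL W p q) (qS W p q t) t := by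
  unfold qL qS
  refine HasDerivAt.fun_sum fun i _ => HasDerivAt.fun_sum fun j _ => ?_
  have hd : 0 < q j + t * p i := add_pos_of_pos_of_nonneg (hq j) (mul_nonneg ht (hp i))
  have h1 : HasDerivAt (fun t : ℝ => q j + t * p i) (p i) t := by
    simpa using ((hasDerivAt_id t).mul_const (p i)).const_add (q j)
  have h2 := (((h1.log hd.ne').sub_const (Real.log (q j))).const_mul (p i)).const_mul (W i j)
  rw [sq, mul_div_assoc]
  exact h2

theorem qL_mono {ι κ : Type*} [Fintype ι] [Fintype κ] (W : ι → ι → ℝ) (p q : ι → ℝ)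
    (W' : κ → κ → ℝ) (p' q' : κ → ℝ)
    (hp : ∀ i, 0 ≤ p i) (hq : ∀ j, 0 < q j) (hp' : ∀ i, 0 ≤ p' i) (hq' : ∀ j, 0 < q' j)
    (hS : ∀ t, 0 ≤ t → qS W' p' q' t ≤ qS W p q t) {T : ℝ} (hT : 0 ≤ T) :
    qL W' p' q' T ≤ qL W p q T := by
  have hder : ∀ t, 0 ≤ t → HasDerivAt (fun t => qL W p q t - qL W' p' q' t)
      (qS W p q t - qS W' p' q' t) t := fun t ht =>
    (qL_hasDerivAt W p q hp hq ht).sub (qL_hasDerivAt W' p' q' hp' hq' ht)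
  have hm : MonotoneOn (fun t => qL W p q t - qL W' p' q' t) (Set.Ici 0) := by
    refine monotoneOn_of_deriv_nonneg (convex_Ici 0)
      (fun t ht => (hder t ht).continuousAt.continuousWithinAt)
      (fun t ht => ?_) (fun t ht => ?_)
    · rw [interior_Ici] at ht
      exact (hder t ht.le).differentiableAt.differentiableWithinAt
    · rw [interior_Ici] at ht
      rw [(hder t ht.le).deriv]
      exact sub_nonneg.2 (hS t ht.le)
  have h := hm (Set.mem_Ici.2 le_rfl) (Set.mem_Ici.2 hT) hT
  have z1 : qL W p q 0 = 0 := by simp [qL]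
  have z2 : qL W' p' q' 0 = 0 := by simp [qL]
  simp only [z1, z2, sub_self] at h
  linarith

theorem qL_tendsto {ι : Type*} [Fintype ι] (W : ι → ι → ℝ) (p q : ι → ℝ)
    (hp : ∀ i, 0 ≤ p i) (hq : ∀ j, 0 < q j) :
    Filter.Tendsto (fun T => qL W p q T - (∑ i, ∑ j, W i j * p i) * Real.log T) Filter.atTop
      (nhds (qD W p q)) := by
  have h1 : (fun T => qL W p q T - (∑ i, ∑ j, W i j * p i) * Real.log T) =ᶠ[Filter.atTop]
      (fun T => ∑ i, ∑ j, W i j * (p i * (Real.log (q j * T⁻¹ + p i) - Real.log (q j)))) := by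
    filter_upwards [Filter.eventually_gt_atTop 0] with T hT
    simp only [qL, Finset.sum_mul, ← Finset.sum_sub_distrib]
    refine Finset.sum_congr rfl fun i _ => Finset.sum_congr rfl fun j _ => ?_
    have hd : 0 < q j * T⁻¹ + p i :=
      add_pos_of_pos_of_nonneg (mul_pos (hq j) (inv_pos.2 hT)) (hp i)
    have : q j + T * p i = T * (q j * T⁻¹ + p i) := by field_simp
    rw [this, Real.log_mul hT.ne' hd.ne']
    ring
  refine Filter.Tendsto.congr' h1.symm ?_
  unfold qD
  refine tendsto_finsetSum _ fun i _ => tendsto_finsetSum _ fun j _ => ?_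
  rcases (hp i).eq_or_lt with h0 | h0
  · simp [← h0]
  · refine Filter.Tendsto.const_mul _ (Filter.Tendsto.const_mul _ (Filter.Tendsto.sub_const ?_ _))
    have : Filter.Tendsto (fun T : ℝ => q j * T⁻¹ + p i) Filter.atTop (nhds (p i)) := by
      simpa using (tendsto_inv_atTop_zero.const_mul (q j)).add_const (p i)
    exact this.log h0.ne'

theorem qD_mono {ι κ : Type*} [Fintype ι] [Fintype κ] (W : ι → ι → ℝ) (p q : ι → ℝ)
    (W' : κ → κ → ℝ) (p' q' : κ → ℝ)
    (hp : ∀ i, 0 ≤ p i) (hq : ∀ j, 0 < q j) (hp' : ∀ i, 0 ≤ p' i) (hq' : ∀ j, 0 < q' j)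
    (hP : ∑ i, ∑ j, W' i j * p' i = ∑ i, ∑ j, W i j * p i)
    (hS : ∀ t, 0 ≤ t → qS W' p' q' t ≤ qS W p q t) :
    qD W' p' q' ≤ qD W p q := by
  refine le_of_tendsto_of_tendsto (qL_tendsto W' p' q' hp' hq') (qL_tendsto W p q hp hq) ?_
  filter_upwards [Filter.eventually_ge_atTop 0] with T hT
  rw [hP]
  exact sub_le_sub_right (qL_mono W p q W' p' q' hp hq hp' hq' hS hT) _

theorem W_sum {ι : Type*} [Fintype ι] [DecidableEq ι] {U V : Matrix ι ι ℂ}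
    (hU : Uᴴ * U = 1) (hV : V * Vᴴ = 1) (i : ι) :
    ∑ j, Complex.normSq ((Uᴴ * V) i j) = 1 := by
  have h : (Uᴴ * V) * (Uᴴ * V)ᴴ = 1 := by
    rw [Matrix.conjTranspose_mul, Matrix.conjTranspose_conjTranspose]
    have : Uᴴ * V * (Vᴴ * U) = Uᴴ * (V * Vᴴ) * U := by simp only [Matrix.mul_assoc]
    rw [this, hV, Matrix.mul_one, hU]
  have h2 := congrFun (congrFun h i) i
  rw [Matrix.mul_apply, Matrix.one_apply_eq] at h2
  simp only [Matrix.conjTranspose_apply, Complex.star_def, Complex.mul_conj] at h2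
  exact_mod_cast h2

theorem qD_eq {ι : Type*} [Fintype ι] [DecidableEq ι] {ρ U V : Matrix ι ι ℂ} {p : ι → ℝ}
    (h : SpecDec ρ U p) (hV : V * Vᴴ = 1) (q : ι → ℝ) :
    qD (fun i j => Complex.normSq ((Uᴴ * V) i j)) p q
      = - vnEntropy ρ - ∑ j, ((Vᴴ * ρ * V) j j).re * Real.log (q j) := by
  have h1 : ∀ j, ((Vᴴ * ρ * V) j j).re = ∑ i, Complex.normSq ((Uᴴ * V) i j) * p i := by
    intro j
    have : Vᴴ * ρ * V = (Uᴴ * V)ᴴ * diagonal (fun i => (p i : ℂ)) * (Uᴴ * V) := by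
      rw [h.eq]
      simp only [Matrix.conjTranspose_mul, Matrix.conjTranspose_conjTranspose, Matrix.mul_assoc]
    rw [this, Matrix.mul_apply, Complex.re_sum]
    refine Finset.sum_congr rfl fun i _ => ?_
    rw [Matrix.mul_diagonal, mul_right_comm,
      Matrix.conjTranspose_apply, Complex.star_def, ← Complex.normSq_eq_conj_mul_self,
      ← Complex.ofReal_mul, Complex.ofReal_re]
  rw [h.entropy, qD]
  simp only [h1, mul_sub, Finset.sum_sub_distrib, ← Finset.sum_mul, W_sum h.unit' hV, one_mul]
  congr 1
  · rw [← Finset.sum_neg_distrib]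
    refine Finset.sum_congr rfl fun i _ => ?_
    rw [Real.negMulLog]; ring
  · rw [Finset.sum_comm]
    refine Finset.sum_congr rfl fun j _ => ?_
    rw [Finset.sum_mul]
    refine Finset.sum_congr rfl fun i _ => ?_
    ring

theorem ptr_trace {α γ : Type*} [Fintype α] [Fintype γ] (M : Matrix (α × γ) (α × γ) ℂ) :
    (ptr M).trace = M.trace := by
  simp [Matrix.trace, ptr, Fintype.sum_prod_type]

/-- Monotonicity of relative entropy under partial trace. -/
theorem relEnt_mono {α γ : Type*} [Fintype α] [Fintype γ] [DecidableEq α] [DecidableEq γ]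
    {ρ σ V : Matrix (α × γ) (α × γ) ℂ} {q : α × γ → ℝ}
    {V' : Matrix α α ℂ} {q' : α → ℝ} (hρ : ρ.PosSemidef) (hρ' : (ptr ρ).PosSemidef)
    (k : SpecDec σ V q) (hq : ∀ j, 0 < q j)
    (k' : SpecDec (ptr σ) V' q') (hq' : ∀ j, 0 < q' j) :
    - vnEntropy (ptr ρ) - ∑ j, ((V'ᴴ * ptr ρ * V') j j).re * Real.log (q' j) ≤
    - vnEntropy ρ - ∑ j, ((Vᴴ * ρ * V) j j).re * Real.log (q j) := by
  obtain ⟨U, p, h, hp⟩ := exists_specDec hρ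
  obtain ⟨U', p', h', hp'⟩ := exists_specDec hρ'
  rw [← qD_eq h k.unit, ← qD_eq h' k'.unit]
  refine qD_mono _ _ _ _ _ _ hp hq hp' hq' ?_ (fun t ht => qS_mono h k hp hq h' k' hp' hq' ht)
  simp only [← Finset.sum_mul, W_sum h.unit' k.unit, W_sum h'.unit' k'.unit, one_mul]
  have := h'.trace
  rw [ptr_trace, h.trace] at this
  exact_mod_cast this.symm

theorem SpecDec.submatrix {ι κ : Type*} [Fintype ι] [DecidableEq ι] [Fintype κ] [DecidableEq κ]
    {M U : Matrix ι ι ℂ} {p : ι → ℝ} (h : SpecDec M U p) (e : κ ≃ ι) :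
    SpecDec (M.submatrix e e) (U.submatrix e e) (p ∘ e) := by
  refine ⟨?_, ?_, ?_⟩
  · rw [Matrix.conjTranspose_submatrix, Matrix.submatrix_mul_equiv, h.unit',
      Matrix.submatrix_one_equiv]
  · rw [Matrix.conjTranspose_submatrix, Matrix.submatrix_mul_equiv, h.unit,
      Matrix.submatrix_one_equiv]
  · have : diagonal (fun i => (((p ∘ e) i : ℝ) : ℂ)) =
        (diagonal (fun i => (p i : ℂ))).submatrix e e := by
      rw [Matrix.submatrix_diagonal_equiv]; rfl
    rw [Matrix.conjTranspose_submatrix, this, Matrix.submatrix_mul_equiv,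
      Matrix.submatrix_mul_equiv, ← h.eq]

theorem SpecDec.add_one {ι : Type*} [Fintype ι] [DecidableEq ι]
    {M U : Matrix ι ι ℂ} {p : ι → ℝ} (h : SpecDec M U p) (ε : ℝ) :
    SpecDec (M + diagonal (fun _ => (ε : ℂ))) U (fun i => p i + ε) := by
  refine ⟨h.unit', h.unit, ?_⟩
  have : diagonal (fun i => ((p i + ε : ℝ) : ℂ)) =
      diagonal (fun i => (p i : ℂ)) + (ε : ℂ) • (1 : Matrix ι ι ℂ) := by
    rw [Matrix.smul_one_eq_diagonal, Matrix.diagonal_add]; simp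
  rw [this, Matrix.mul_add, Matrix.add_mul, ← h.eq, Matrix.mul_smul, Matrix.smul_mul,
    Matrix.mul_one, h.unit, Matrix.smul_one_eq_diagonal]

theorem SpecDec.one {ι : Type*} [Fintype ι] [DecidableEq ι] :
    SpecDec (1 : Matrix ι ι ℂ) 1 (fun _ => 1) := by
  refine ⟨by simp, by simp, by simp⟩

/-- Partial trace over the first factor. -/
noncomputable def ptl {α γ : Type*} [Fintype α] (M : Matrix (α × γ) (α × γ) ℂ) : Matrix γ γ ℂ :=
  fun b c => ∑ a, M (a, b) (a, c)

theorem ptr_posSemidef {α γ : Type*} [Fintype α] [Fintype γ]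
    {M : Matrix (α × γ) (α × γ) ℂ} (h : M.PosSemidef) : (ptr M).PosSemidef := by
  have : ptr M = ∑ c : γ, M.submatrix (fun a => (a, c)) (fun a => (a, c)) := by
    ext a b; simp [ptr, Matrix.sum_apply]
  rw [this]
  exact Matrix.posSemidef_sum _ fun c _ => h.submatrix _

theorem ptl_posSemidef {α γ : Type*} [Fintype α] [Fintype γ]
    {M : Matrix (α × γ) (α × γ) ℂ} (h : M.PosSemidef) : (ptl M).PosSemidef := by
  have : ptl M = ∑ c : α, M.submatrix (fun a => (c, a)) (fun a => (c, a)) := by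
    ext a b; simp [ptl, Matrix.sum_apply]
  rw [this]
  exact Matrix.posSemidef_sum _ fun c _ => h.submatrix _

theorem ptl_conj {α γ : Type*} [Fintype α] [Fintype γ] [DecidableEq α] [DecidableEq γ]
    (N : Matrix (α × γ) (α × γ) ℂ) (V : Matrix γ γ ℂ) :
    ptl ((kroneckerMap (· * ·) (1 : Matrix α α ℂ) V)ᴴ * N *
      kroneckerMap (· * ·) (1 : Matrix α α ℂ) V) = Vᴴ * ptl N * V := by
  ext b c
  simp only [ptl, Matrix.mul_apply, Fintype.sum_prod_type, conjTranspose_kronecker,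
    Matrix.conjTranspose_one, kroneckerMap_apply, Matrix.one_apply, ite_mul, mul_ite, one_mul,
    zero_mul, mul_zero, Finset.sum_ite_eq, Finset.mem_univ, if_true, Finset.sum_const_zero,
    Finset.sum_ite_irrel, Finset.mul_sum, Finset.sum_mul, Finset.sum_ite_eq']
  rw [Finset.sum_comm]
  refine Finset.sum_congr rfl fun x _ => ?_
  rw [Finset.sum_comm]

theorem SpecDec.conj_apply {ι : Type*} [Fintype ι] [DecidableEq ι]
    {M U : Matrix ι ι ℂ} {p : ι → ℝ} (h : SpecDec M U p) (i : ι) :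
    ((Uᴴ * M * U) i i) = p i := by
  have : Uᴴ * M * U = (Uᴴ * U) * diagonal (fun i => (p i : ℂ)) * (Uᴴ * U) := by
    rw [h.eq]; simp only [Matrix.mul_assoc]
  rw [this, h.unit', Matrix.one_mul, Matrix.mul_one, Matrix.diagonal_apply_eq]

theorem sum_log_kron {α γ : Type*} [Fintype α] [Fintype γ] [DecidableEq α] [DecidableEq γ]
    (N : Matrix (α × γ) (α × γ) ℂ) {V : Matrix γ γ ℂ} {q : γ → ℝ} (h : SpecDec (ptl N) V q)
    (f : γ → ℝ) :
    ∑ j, (((kroneckerMap (· * ·) (1 : Matrix α α ℂ) V)ᴴ * N *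
      kroneckerMap (· * ·) (1 : Matrix α α ℂ) V) j j).re * f j.2 = ∑ k, q k * f k := by
  rw [Fintype.sum_prod_type, Finset.sum_comm]
  refine Finset.sum_congr rfl fun k _ => ?_
  dsimp only
  rw [← Finset.sum_mul]
  congr 1
  have := congrFun (congrFun (ptl_conj N V) k) k
  rw [h.conj_apply, ptl] at this
  rw [← Complex.re_sum, this, Complex.ofReal_re]

/-- Strong subadditivity. -/
theorem ssa {A B C : Type*} [Fintype A] [Fintype B] [Fintype C] [DecidableEq A] [DecidableEq B]
    [DecidableEq C] [Nonempty C]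
    {ρ : Matrix ((A × B) × C) ((A × B) × C) ℂ} (hρ : ρ.PosSemidef) :
    vnEntropy ρ + vnEntropy (ptl (ptr ρ)) ≤ vnEntropy (ptr ρ) +
      vnEntropy (ptl (ρ.submatrix (Equiv.prodAssoc A B C).symm (Equiv.prodAssoc A B C).symm)) := by
  set e := Equiv.prodAssoc A B C with he
  set N := ρ.submatrix e.symm e.symm with hN
  have hNp : N.PosSemidef := hρ.submatrix _
  obtain ⟨V, q, k, hq⟩ := exists_specDec (ptl_posSemidef hNp)
  obtain ⟨V', q', k', hq'⟩ := exists_specDec (ptl_posSemidef (ptr_posSemidef hρ))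
  have hcard : (0 : ℝ) < Fintype.card C := by exact_mod_cast Fintype.card_pos
  have key : ∀ ε : ℝ, 0 < ε →
      - vnEntropy (ptr ρ) - ∑ j, q' j * Real.log (q' j + Fintype.card C * ε) ≤
      - vnEntropy ρ - ∑ j, q j * Real.log (q j + ε) := by
    intro ε hε
    have s1 := ((SpecDec.one (ι := A)).kronecker (k.add_one ε)).submatrix e
    have s2 := (SpecDec.one (ι := A)).kronecker (k'.add_one (Fintype.card C * ε))
    have hs : kroneckerMap (· * ·) (1 : Matrix A A ℂ)
        (ptl (ptr ρ) + diagonal (fun _ => ((Fintype.card C * ε : ℝ) : ℂ))) =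
        ptr ((kroneckerMap (· * ·) (1 : Matrix A A ℂ)
          (ptl N + diagonal (fun _ => ((ε : ℝ) : ℂ)))).submatrix e e) := by
      ext ⟨a, b⟩ ⟨a', b'⟩
      change (1 : Matrix A A ℂ) a a' * ((∑ a, ∑ c, ρ ((a, b), c) ((a, b'), c)) +
          diagonal (fun _ => ((Fintype.card C * ε : ℝ) : ℂ)) b b') =
        ∑ x, (1 : Matrix A A ℂ) a a' * ((∑ a, ρ ((a, b), x) ((a, b'), x)) +
          diagonal (fun _ => ((ε : ℝ) : ℂ)) (b, x) (b', x))
      rw [← Finset.mul_sum, Finset.sum_add_distrib, Finset.sum_comm]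
      congr 2
      · by_cases hb : b = b'
        · subst hb; simp
        · simp [Matrix.diagonal_apply, hb]
    rw [hs] at s2
    have := relEnt_mono hρ (ptr_posSemidef hρ) s1
      (fun j => by
        have := hq (e j).2
        simp only [Function.comp_apply, one_mul]; linarith) s2
      (fun j => by
        have := hq' j.2
        have := mul_pos hcard hε
        simp only [one_mul]; linarith)
    simp only [one_mul, Function.comp_apply] at this
    rw [sum_log_kron (ptr ρ) k' (fun j => Real.log (q' j + Fintype.card C * ε))] at this
    have hρN : ρ = N.submatrix e e := by
      ext x y; simp [hN]
    have h3 : ∑ j, ((((kroneckerMap (· * ·) (1 : Matrix A A ℂ) V).submatrix e e)ᴴ * ρ *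
        ((kroneckerMap (· * ·) (1 : Matrix A A ℂ) V).submatrix e e)) j j).re *
          Real.log (q (e j).2 + ε) = ∑ k, q k * Real.log (q k + ε) := by
      rw [← sum_log_kron N k (fun j => Real.log (q j + ε)), ← Equiv.sum_comp e]
      rw [hρN, Matrix.conjTranspose_submatrix, Matrix.submatrix_mul_equiv,
        Matrix.submatrix_mul_equiv]
      rfl
    rw [h3] at this
    exact this
  have lim : ∀ (x : ℝ) (d : ℝ), Filter.Tendsto (fun ε : ℝ => x * Real.log (x + d * ε))
      (nhdsWithin 0 (Set.Ioi 0)) (nhds (- Real.negMulLog x)) := by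
    intro x d
    rcases eq_or_ne x 0 with h0 | h0
    · simp [h0]
    · have h1 : Filter.Tendsto (fun ε : ℝ => x + d * ε) (nhdsWithin 0 (Set.Ioi 0)) (nhds x) := by
        have : Filter.Tendsto (fun ε : ℝ => x + d * ε) (nhds 0) (nhds (x + d * 0)) :=
          Continuous.tendsto (by fun_prop) 0
        rw [mul_zero, add_zero] at this
        exact this.mono_left nhdsWithin_le_nhds
      have h2 := (h1.log h0).const_mul x
      simpa [Real.negMulLog] using h2
  have L1 : Filter.Tendsto (fun ε : ℝ =>
      - vnEntropy (ptr ρ) - ∑ j, q' j * Real.log (q' j + Fintype.card C * ε))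
      (nhdsWithin 0 (Set.Ioi 0)) (nhds (- vnEntropy (ptr ρ) - ∑ j, - Real.negMulLog (q' j))) :=
    (tendsto_finsetSum _ fun j _ => lim (q' j) _).const_sub _
  have L2 : Filter.Tendsto (fun ε : ℝ =>
      - vnEntropy ρ - ∑ j, q j * Real.log (q j + ε))
      (nhdsWithin 0 (Set.Ioi 0)) (nhds (- vnEntropy ρ - ∑ j, - Real.negMulLog (q j))) :=
    (tendsto_finsetSum _ fun j _ => by simpa using lim (q j) 1).const_sub _
  have fin := le_of_tendsto_of_tendsto L1 L2 (by
    filter_upwards [self_mem_nhdsWithin] with ε hε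
    exact key ε hε)
  rw [Finset.sum_neg_distrib, Finset.sum_neg_distrib, ← k.entropy, ← k'.entropy] at fin
  linarith


theorem ptl_trace {α γ : Type*} [Fintype α] [Fintype γ] (M : Matrix (α × γ) (α × γ) ℂ) :
    (ptl M).trace = M.trace := by
  simp only [Matrix.trace, ptl, Fintype.sum_prod_type, Matrix.diag_apply]
  rw [Finset.sum_comm]

theorem vnEntropy_unit {M : Matrix Unit Unit ℂ} (h : M.PosSemidef) (ht : M.trace = 1) :
    vnEntropy M = 0 := by
  obtain ⟨U, p, k, -⟩ := exists_specDec h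
  have h1 : ∑ i, p i = 1 := by have := k.trace; rw [ht] at this; exact_mod_cast this.symm
  rw [k.entropy]
  simp only [Finset.univ_unique, Finset.sum_singleton] at h1 ⊢
  rw [h1, Real.negMulLog_one]

theorem subadditivity {A C : Type*} [Fintype A] [Fintype C] [DecidableEq A]
    [DecidableEq C] [Nonempty C] {ρ : Matrix (A × C) (A × C) ℂ} (hρ : ρ.PosSemidef)
    (ht : ρ.trace = 1) :
    vnEntropy ρ ≤ vnEntropy (ptr ρ) + vnEntropy (ptl ρ) := by
  let e1 : A × Unit ≃ A := Equiv.prodPUnit A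
  let e2 : Unit × C ≃ C := Equiv.punitProd C
  let e : (A × Unit) × C ≃ A × C := Equiv.prodCongr e1 (Equiv.refl C)
  have hρ' : (ρ.submatrix e e).PosSemidef := hρ.submatrix e
  have h := ssa hρ'
  rw [vnEntropy_submatrix e hρ.1] at h
  have h1 : ptr (ρ.submatrix e e) = (ptr ρ).submatrix e1 e1 := by
    ext a b; rfl
  have h2 : ptl ((ρ.submatrix e e).submatrix (Equiv.prodAssoc A Unit C).symm
      (Equiv.prodAssoc A Unit C).symm) = (ptl ρ).submatrix e2 e2 := by
    ext a b; rfl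
  have h3 : vnEntropy (ptl (ptr (ρ.submatrix e e))) = 0 := by
    refine vnEntropy_unit (ptl_posSemidef (ptr_posSemidef hρ')) ?_
    rw [ptl_trace, ptr_trace, ← ht]
    simp only [Matrix.trace, Matrix.diag_apply, Matrix.submatrix_apply]
    exact Equiv.sum_comp e (fun x => ρ x x)
  rw [h2, h3, h1, vnEntropy_submatrix e1 (ptr_posSemidef hρ).1,
    vnEntropy_submatrix e2 (ptl_posSemidef hρ).1] at h
  linarith

/-- **Mutual-information corollary of Theorem 2 of the paper.** Under the hypotheses of
Theorem 2, the quantum mutual information between the parties `A = (a1, a2)` and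
`B = (b1, b2)` is bounded by the local entropy of `A`:
`S(ρ^{a1 a2}) + S(ρ^{b1 b2}) − S(ρ^{a1 a2 b1 b2}) ≤ S(ρ^{a1 a2})`. -/
theorem mutual_info_bounded_of_indefinite_causal_structure
    {ι1 ι2 ι5 ι6 : Type*} [Fintype ι1] [Fintype ι2] [Fintype ι5] [Fintype ι6]
    [DecidableEq ι1] [DecidableEq ι2] [DecidableEq ι5] [DecidableEq ι6]
    [Nonempty ι1] [Nonempty ι2] [Nonempty ι5] [Nonempty ι6]
    (ρ : Matrix (ι1 × ι2 × ι1 × ι2 × ι5 × ι6) (ι1 × ι2 × ι1 × ι2 × ι5 × ι6) ℂ)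
    (hpure : IsPureDensityMatrix ρ)
    (hfact : ∀ (x1 y1 : ι1) (x2 y2 x4 y4 : ι2),
      redA1A2B2 ρ (x1, x2, x4) (y1, y2, y4)
        = redA1B2 ρ (x1, x4) (y1, y4) * redA2 ρ x2 y2)
    (hsymm : ∀ (x1 x3 x1' x3' : ι1) (x2 x4 x2' x4' : ι2),
      redA1A2B1B2 ρ (x1, x2, x3, x4) (x1', x2', x3', x4')
        = redA1A2B1B2 ρ (x3, x4, x1, x2) (x3', x4', x1', x2'))
    (hb1e1 : vnEntropy (redB1 ρ) ≤ vnEntropy (redE1 ρ))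
    (ha1b2 : vnEntropy (redB1E1 ρ) ≤ vnEntropy (redA1B2 ρ)) :
    vnEntropy (redA1A2 ρ) + vnEntropy (redB1B2 ρ) - vnEntropy (redA1A2B1B2 ρ)
      ≤ vnEntropy (redA1A2 ρ) := by
  obtain ⟨⟨-, htr⟩, w, -, hρ⟩ := hpure
  have hw : ∀ x y, ρ x y = w x * star (w y) := fun x y => by rw [hρ]; rfl
  clear hρ
  have htr' : ∑ x1 : ι1, ∑ x2 : ι2, ∑ x3 : ι1, ∑ x4 : ι2, ∑ x5 : ι5, ∑ x6 : ι6,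
      ρ (x1, x2, x3, x4, x5, x6) (x1, x2, x3, x4, x5, x6) = 1 := by
    rw [← htr]
    simp only [Matrix.trace, Matrix.diag_apply, Fintype.sum_prod_type]
  -- positivity
  have pA1B2 : (redA1B2 ρ).PosSemidef := by
    let X : Matrix (ι1 × ι2) (ι2 × ι1 × ι5 × ι6) ℂ :=
      fun p y => w (p.1, y.1, y.2.1, p.2, y.2.2.1, y.2.2.2)
    have : redA1B2 ρ = X * Xᴴ := by
      ext p q
      simp only [redA1B2, hw, Matrix.mul_apply, Fintype.sum_prod_type, Matrix.conjTranspose_apply]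
      rfl
    rw [this]
    exact Matrix.posSemidef_self_mul_conjTranspose X
  have pA2 : (redA2 ρ).PosSemidef := by
    let X : Matrix ι2 (ι1 × ι1 × ι2 × ι5 × ι6) ℂ :=
      fun p y => w (y.1, p, y.2.1, y.2.2.1, y.2.2.2.1, y.2.2.2.2)
    have : redA2 ρ = X * Xᴴ := by
      ext p q
      simp only [redA2, hw, Matrix.mul_apply, Fintype.sum_prod_type, Matrix.conjTranspose_apply]
      rfl
    rw [this]
    exact Matrix.posSemidef_self_mul_conjTranspose X
  have pB1B2 : (redB1B2 ρ).PosSemidef := by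
    let X : Matrix (ι1 × ι2) (ι1 × ι2 × ι5 × ι6) ℂ :=
      fun p y => w (y.1, y.2.1, p.1, p.2, y.2.2.1, y.2.2.2)
    have : redB1B2 ρ = X * Xᴴ := by
      ext p q
      simp only [redB1B2, hw, Matrix.mul_apply, Fintype.sum_prod_type, Matrix.conjTranspose_apply]
      rfl
    rw [this]
    exact Matrix.posSemidef_self_mul_conjTranspose X
  -- traces
  have tA1B2 : (redA1B2 ρ).trace = 1 := by
    rw [← htr']
    simp only [Matrix.trace, Matrix.diag_apply, Fintype.sum_prod_type, redA1B2]
    refine Finset.sum_congr rfl fun x1 _ => ?_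
    rw [Finset.sum_comm]
    refine Finset.sum_congr rfl fun x2 _ => ?_
    rw [Finset.sum_comm]
  have tA2 : (redA2 ρ).trace = 1 := by
    rw [← htr']
    simp only [Matrix.trace, Matrix.diag_apply, redA2]
    rw [Finset.sum_comm]
  -- marginals of `b1 b2`
  have mB1 : ptr (redB1B2 ρ) = redB1 ρ := by
    ext p q
    simp only [ptr, redB1B2, redB1]
    rw [Finset.sum_comm]
    refine Finset.sum_congr rfl fun x1 _ => ?_
    rw [Finset.sum_comm]
  have mB2 : ptl (redB1B2 ρ) = redA2 ρ := by
    ext p q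
    have l : ptl (redB1B2 ρ) p q = ∑ x3 : ι1, ∑ x1 : ι1, ∑ x2 : ι2,
        redA1A2B1B2 ρ (x1, x2, x3, p) (x1, x2, x3, q) := rfl
    have r : redA2 ρ p q = ∑ x1 : ι1, ∑ x3 : ι1, ∑ x4 : ι2,
        redA1A2B1B2 ρ (x1, p, x3, x4) (x1, q, x3, x4) := rfl
    rw [l, r]
    refine Finset.sum_congr rfl fun x3 _ => Finset.sum_congr rfl fun x1 _ =>
      Finset.sum_congr rfl fun x2 _ => ?_
    exact hsymm _ _ _ _ _ _ _ _
  have tB1B2 : (redB1B2 ρ).trace = 1 := by rw [← ptl_trace, mB2, tA2]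
  have hsub := subadditivity pB1B2 tB1B2
  rw [mB1, mB2] at hsub
  -- the state on `b1 e1 e2`
  let X : Matrix ((ι1 × ι5) × ι6) (ι1 × ι2 × ι2) ℂ :=
    fun y p => w (p.1, p.2.1, y.1.1, p.2.2, y.1.2, y.2)
  have hX : vnEntropy (X * Xᴴ) = vnEntropy (redA1A2B2 ρ) := by
    rw [vnEntropy_pure]
    congr 1
    ext p q
    simp only [redA1A2B2, hw, Matrix.mul_apply, Fintype.sum_prod_type,
      Matrix.conjTranspose_apply, Matrix.transpose_apply]
    rfl
  have hfac : vnEntropy (redA1A2B2 ρ) = vnEntropy (redA1B2 ρ) + vnEntropy (redA2 ρ) := by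
    let e : ι1 × ι2 × ι2 ≃ (ι1 × ι2) × ι2 :=
      { toFun := fun x => ((x.1, x.2.2), x.2.1)
        invFun := fun x => (x.1.1, x.2, x.1.2)
        left_inv := fun x => rfl
        right_inv := fun x => rfl }
    have h1 : redA1A2B2 ρ =
        (kroneckerMap (· * ·) (redA1B2 ρ) (redA2 ρ)).submatrix e e := by
      ext ⟨x1, x2, x4⟩ ⟨y1, y2, y4⟩
      exact hfact x1 y1 x2 y2 x4 y4
    obtain ⟨_, _, d1, -⟩ := exists_specDec pA1B2
    obtain ⟨_, _, d2, -⟩ := exists_specDec pA2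
    rw [h1, vnEntropy_submatrix e (d1.kronecker d2).isHermitian,
      vnEntropy_kronecker pA1B2 pA2 tA1B2 tA2]
  have hB1E1 : ptr (X * Xᴴ) = redB1E1 ρ := by
    ext p q
    simp only [ptr, redB1E1, hw, Matrix.mul_apply, Fintype.sum_prod_type,
      Matrix.conjTranspose_apply]
    rw [Finset.sum_comm]
    refine Finset.sum_congr rfl fun x1 _ => ?_
    rw [Finset.sum_comm]
    refine Finset.sum_congr rfl fun x2 _ => ?_
    rw [Finset.sum_comm]
    first | done | rfl
  have hE1 : ptl (redB1E1 ρ) = redE1 ρ := by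
    ext p q
    simp only [ptl, redB1E1, redE1]
    rw [Finset.sum_comm]
    refine Finset.sum_congr rfl fun x1 _ => ?_
    rw [Finset.sum_comm]
  have hE1E2 : vnEntropy (ptl ((X * Xᴴ).submatrix (Equiv.prodAssoc ι1 ι5 ι6).symm
      (Equiv.prodAssoc ι1 ι5 ι6).symm)) = vnEntropy (redA1A2B1B2 ρ) := by
    let G : Matrix (ι1 × ι2 × ι1 × ι2) (ι5 × ι6) ℂ :=
      fun p y => w (p.1, p.2.1, p.2.2.1, p.2.2.2, y.1, y.2)
    have h1 : redA1A2B1B2 ρ = G * Gᴴ := by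
      ext p q
      simp only [redA1A2B1B2, hw, Matrix.mul_apply, Fintype.sum_prod_type,
        Matrix.conjTranspose_apply]
      rfl
    have h2 : ptl ((X * Xᴴ).submatrix (Equiv.prodAssoc ι1 ι5 ι6).symm
        (Equiv.prodAssoc ι1 ι5 ι6).symm) = Gᵀ * Gᵀᴴ := by
      ext p q
      simp only [ptl, Matrix.submatrix_apply, Equiv.prodAssoc_symm_apply, Matrix.mul_apply,
        Fintype.sum_prod_type, Matrix.conjTranspose_apply, Matrix.transpose_apply]
      rw [Finset.sum_comm]
      refine Finset.sum_congr rfl fun x1 _ => ?_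
      rw [Finset.sum_comm]
      first | done | rfl
    rw [h1, h2, vnEntropy_pure, Matrix.transpose_transpose]
  have hssa := ssa (Matrix.posSemidef_self_mul_conjTranspose X)
  rw [hE1E2, hB1E1, hE1, hX, hfac] at hssa
  linarith
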